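/- (Submodularity of the coding rate, Lemma 2.) Let Ω be a finite index set, z : Ω → ℝ^d a family of vectors, λ ≥ 0, and define f(S) = log det(I_d + λ Σ_{j∈S} z_j z_jᵀ) for S ⊆ Ω. Then f is submodular: for any subsets A ⊆ B ⊆ Ω and any element i ∈ Ω with i ∉ B, f(A ∪ {i}) − f(A) ≥ f(B ∪ {i}) − f(B). -/

import Mathlib

open Matrix

/-- Inversion reverses the Loewner order, stated for the associated quadratic forms. -/
theorem dotProduct_inv_mulVec_le {n : Type*} [Fintype n] [DecidableEq n] {P Q : Matrix n n ℝ}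
    (hP : P.PosDef) (hQ : Q.PosDef) (hPQ : (Q - P).PosSemidef) (v : n → ℝ) :
    v ⬝ᵥ (Q⁻¹ *ᵥ v) ≤ v ⬝ᵥ (P⁻¹ *ᵥ v) := by
  set x := P⁻¹ *ᵥ v with hx
  set y := Q⁻¹ *ᵥ v with hy
  have hPx : P *ᵥ x = v := by
    rw [hx, mulVec_mulVec, mul_nonsing_inv _ ((isUnit_iff_isUnit_det _).1 hP.isUnit), one_mulVec]
  have hQy : Q *ᵥ y = v := by
    rw [hy, mulVec_mulVec, mul_nonsing_inv _ ((isUnit_iff_isUnit_det _).1 hQ.isUnit), one_mulVec]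
  have hPt : Pᵀ = P := by simpa using hP.isHermitian.eq
  have hxy : x ⬝ᵥ (P *ᵥ y) = v ⬝ᵥ y := by
    rw [dotProduct_mulVec, ← mulVec_transpose, hPt, hPx]
  have h₁ := hP.posSemidef.dotProduct_mulVec_nonneg (x - y)
  have h₂ := hPQ.dotProduct_mulVec_nonneg y
  simp only [star_trivial, mulVec_sub, sub_mulVec, dotProduct_sub, sub_dotProduct, hPx, hQy, hxy]
    at h₁ h₂
  rw [dotProduct_comm x v] at h₁
  rw [dotProduct_comm y v] at h₁ h₂
  linarith

/-- The **matrix determinant lemma** for a scaled symmetric rank-one update. -/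
theorem det_add_smul_vecMulVec {n R : Type*} [Fintype n] [DecidableEq n] [CommRing R]
    {P : Matrix n n R} (hP : IsUnit P.det) (c : R) (v : n → R) :
    (P + c • vecMulVec v v).det = P.det * (1 + c * (v ⬝ᵥ (P⁻¹ *ᵥ v))) := by
  rw [← smul_vecMulVec, vecMulVec_eq Unit, det_add_replicateCol_mul_replicateRow hP]
  congr 1
  rw [← replicateRow_vecMul, ← replicateCol_mulVec]
  have h : (replicateRow Unit (v ᵥ* P⁻¹) *ᵥ v) () = v ⬝ᵥ (P⁻¹ *ᵥ v) :=
    (dotProduct_mulVec v P⁻¹ v).symm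
  simp [mulVec_smul, h]

theorem posSemidef_smul_sum_vecMulVec {ι n : Type*} [Fintype n] {l : ℝ} (hl : 0 ≤ l)
    (z : ι → n → ℝ) (S : Finset ι) : (l • ∑ j ∈ S, vecMulVec (z j) (z j)).PosSemidef :=
  (posSemidef_sum S fun j _ => by simpa using posSemidef_vecMulVec_self_star (z j)).smul hl

theorem coding_rate_submodular {Ω : Type*} [Fintype Ω] [DecidableEq Ω]
    (d : ℕ) (z : Ω → Fin d → ℝ) (l : ℝ) (hl : 0 ≤ l)
    (f : Finset Ω → ℝ)
    (hf : ∀ S : Finset Ω,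
      f S = Real.log ((1 : Matrix (Fin d) (Fin d) ℝ)
              + l • ∑ j ∈ S, vecMulVec (z j) (z j)).det)
    (A B : Finset Ω) (hAB : A ⊆ B) (i : Ω) (hi : i ∉ B) :
    f (insert i A) - f A ≥ f (insert i B) - f B := by
  have hpos (S : Finset Ω) : ((1 : Matrix (Fin d) (Fin d) ℝ)
      + l • ∑ j ∈ S, vecMulVec (z j) (z j)).PosDef :=
    PosDef.one.add_posSemidef (posSemidef_smul_sum_vecMulVec hl z S)
  have hquad (S : Finset Ω) : 0 ≤ l * (z i ⬝ᵥ (((1 : Matrix (Fin d) (Fin d) ℝ)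
      + l • ∑ j ∈ S, vecMulVec (z j) (z j))⁻¹ *ᵥ z i)) :=
    mul_nonneg hl (by simpa using (hpos S).inv.posSemidef.dotProduct_mulVec_nonneg (z i))
  have hgain (S : Finset Ω) (hS : i ∉ S) : f (insert i S) - f S =
      Real.log (1 + l * (z i ⬝ᵥ (((1 : Matrix (Fin d) (Fin d) ℝ)
        + l • ∑ j ∈ S, vecMulVec (z j) (z j))⁻¹ *ᵥ z i))) := by
    rw [hf, hf, Finset.sum_insert hS, smul_add, add_comm (l • vecMulVec _ _), ← add_assoc,
      det_add_smul_vecMulVec (hpos S).det_pos.ne'.isUnit,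
      Real.log_mul (hpos S).det_pos.ne' (by linarith [hquad S]), add_sub_cancel_left]
  rw [hgain A fun h => hi (hAB h), hgain B hi]
  refine Real.log_le_log (by linarith [hquad B]) ?_
  gcongr
  refine dotProduct_inv_mulVec_le (hpos A) (hpos B) ?_ (z i)
  rw [add_sub_add_left_eq_sub, ← smul_sub, ← Finset.sum_sdiff hAB, add_sub_cancel_right]
  exact posSemidef_smul_sum_vecMulVec hl z _
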